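/- arXiv:0809.4580 — 2 statements merged into one kernel-verified Lean document; each statement's English description precedes it below -/
import Mathlib

section
/- Let Ω ⊂ ℝ^n be an open bounded convex set containing the origin, with support function h and Gauss map ν of cl(Ω), let f ∈ C(S^{n−1}), and let h_t denote the support function of B[h + tf] (for |t| sufficiently small). Let x ∈ ∂Ω be a point at which ν is continuous, and set X = ν(x). If X_t ∈ S^{n−1} are points with X_t → X as t → 0, then lim_{t→0} (h_t(X_t) − h(X_t))/t = f(X). -/
open MeasureTheory Metric Set Filter Bornology
open scoped Topology Pointwise RealInnerProductSpace ENNReal NNReal BigOperators Classical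

noncomputable section

/-- Euclidean `n`-space. -/
abbrev Euc (n : ℕ) : Type := EuclideanSpace ℝ (Fin n)

variable {n : ℕ}

/-- The Laplacian of `u`, as the sum of the pure second derivatives in the coordinate
directions. -/
def lapl (u : Euc n → ℝ) (x : Euc n) : ℝ :=
  ∑ i : Fin n, iteratedFDeriv ℝ 2 u x (fun _ => EuclideanSpace.single i (1 : ℝ))

/-- `u` is the torsion function of `Ω`: the solution of `Δu = -2` in `Ω`, `u = 0` on `∂Ω`,
continuous up to the boundary and smooth inside. -/
structure IsTorsionFunction (Ω : Set (Euc n)) (u : Euc n → ℝ) : Prop where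
  continuousOn : ContinuousOn u (closure Ω)
  smooth : ContDiffOn ℝ (⊤ : ℕ∞) u Ω
  lapl_eq : ∀ x ∈ Ω, lapl u x = -2
  boundary_zero : ∀ x ∈ frontier Ω, u x = 0

/-- The torsional rigidity `τ(Ω) = ∫_Ω ‖∇u‖²` where `u` is the torsion function of `Ω`. -/
def torsionRigidity (Ω : Set (Euc n)) : ℝ :=
  if h : ∃ u, IsTorsionFunction Ω u then ∫ x in Ω, ‖gradient h.choose x‖ ^ 2 else 0

/-- The nontangential cone `Γ_α(x̄) = {x ∈ Ω : |x - x̄| ≤ (1+α) dist(x, ∂Ω)}`. -/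
def ntCone (Ω : Set (Euc n)) (x : Euc n) (α : ℝ) : Set (Euc n) :=
  {y ∈ Ω | dist y x ≤ (1 + α) * infDist y (frontier Ω)}

/-- `w` has nontangential limit `L` at the boundary point `x`. -/
def HasNTLimitAt {F : Type*} [TopologicalSpace F] (Ω : Set (Euc n)) (w : Euc n → F)
    (x : Euc n) (L : F) : Prop :=
  ∀ α > 0, Tendsto w (𝓝[ntCone Ω x α] x) (𝓝 L)

/-- The nontangential boundary values of `∇u` (junk value `0` where they do not exist). -/
def ntGradient (Ω : Set (Euc n)) (u : Euc n → ℝ) (x : Euc n) : Euc n :=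
  if h : ∃ L, HasNTLimitAt Ω (gradient u) x L then h.choose else 0

/-- `X` is an outer unit normal to `K` at `x`. -/
def IsOuterNormalAt (K : Set (Euc n)) (x X : Euc n) : Prop :=
  ‖X‖ = 1 ∧ ∀ y ∈ K, ⟪y, X⟫ ≤ ⟪x, X⟫

/-- The Gauss map of `K`: the outer unit normal at the points of `∂K` where it is unique
(i.e. where `∂K` is differentiable), junk value `0` elsewhere. -/
def gaussMap (K : Set (Euc n)) (x : Euc n) : Euc n :=
  if h : ∃! X, IsOuterNormalAt K x X then h.choose else 0

/-- The support function of a set: `h_K(X) = sup_{y ∈ K} ⟨y, X⟩`. -/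
def suppFn (K : Set (Euc n)) (X : Euc n) : ℝ :=
  sSup ((fun y => ⟪y, X⟫) '' K)

/-- The measure `μ_{τ,Ω}(η) = ∫_{ν⁻¹(η)} |∇u|² dH^{n-1}` (as a set function on Borel sets
`η ⊆ S^{n-1}`), where `ν` is the Gauss map and `∇u` is taken in the sense of nontangential
limits. -/
def torsionMeasure (Ω : Set (Euc n)) (u : Euc n → ℝ) (η : Set (Euc n)) : ℝ≥0∞ :=
  ∫⁻ x in frontier Ω ∩ gaussMap (closure Ω) ⁻¹' η,
    ENNReal.ofReal (‖ntGradient Ω u x‖ ^ 2) ∂μH[(n : ℝ) - 1]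

/-- The mixed torsional rigidity `τ₁(Ω, Ω') = ∫_{∂Ω} h_{Ω'}(ν(x)) ‖∇u(x)‖² dH^{n-1}(x)`. -/
def mixedTorsion (Ω Ω' : Set (Euc n)) : ℝ :=
  if h : ∃ u, IsTorsionFunction Ω u then
    ∫ x in frontier Ω,
      suppFn (closure Ω') (gaussMap (closure Ω) x) * ‖ntGradient Ω h.choose x‖ ^ 2
        ∂μH[(n : ℝ) - 1]
  else 0

/-- The Alexandrov body `B[g] = {x : ⟨x, X⟩ ≤ g(X) for all X ∈ S^{n-1}}` of a positive
continuous function `g` on the sphere. -/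
def alexandrovBody (g : Euc n → ℝ) : Set (Euc n) :=
  {x | ∀ X ∈ sphere (0 : Euc n) 1, ⟪x, X⟫ ≤ g X}

/-- On a compact set, a continuous function that is positive on the zero set of `p ≥ 0` is bounded
below by a multiple of `-p`. -/
lemma exists_neg_le_mul_of_pos_on_zero {α : Type*} [TopologicalSpace α] {S : Set α}
    (hS : IsCompact S) {p g : α → ℝ} (hp : ContinuousOn p S) (hg : ContinuousOn g S)
    (hp0 : ∀ a ∈ S, 0 ≤ p a) (hpg : ∀ a ∈ S, p a = 0 → 0 < g a) :
    ∃ M : ℝ, 0 ≤ M ∧ ∀ a ∈ S, -g a ≤ M * p a := by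
  obtain ⟨G, hG⟩ := hS.exists_bound_of_continuousOn hg
  have hm : ContinuousOn (fun a => max (p a) (g a)) S := hp.sup hg
  obtain ⟨δ, hδ, hδm⟩ : ∃ δ : ℝ, 0 < δ ∧ ∀ a ∈ S, δ ≤ max (p a) (g a) := by
    refine hS.exists_forall_le' hm fun a ha => ?_
    rcases (hp0 a ha).eq_or_lt with h | h
    · exact lt_max_of_lt_right (hpg a ha h.symm)
    · exact lt_max_of_lt_left h
  refine ⟨|G| / δ, by positivity, fun a ha => ?_⟩
  have hp0a := hp0 a ha
  rcases le_max_iff.1 (hδm a ha) with h | h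
  · calc -g a ≤ |g a| := neg_le_abs _
      _ ≤ |G| := (hG a ha).trans (le_abs_self G)
      _ = |G| / δ * δ := by field_simp
      _ ≤ |G| / δ * p a := by gcongr
  · have : 0 ≤ |G| / δ * p a := by positivity
    linarith

lemma continuous_suppFn {K : Set (Euc n)} (hK : IsCompact K) : Continuous (suppFn K) :=
  hK.continuous_sSup (f := fun X y => ⟪y, X⟫) (by fun_prop)

lemma inner_le_suppFn {K : Set (Euc n)} (hK : IsCompact K) {y : Euc n} (hy : y ∈ K)
    (Y : Euc n) : ⟪y, Y⟫ ≤ suppFn K Y :=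
  le_csSup (hK.bddAbove_image (by fun_prop)) (mem_image_of_mem _ hy)

lemma exists_inner_eq_suppFn {K : Set (Euc n)} (hK : IsCompact K) (hne : K.Nonempty)
    (Y : Euc n) : ∃ v ∈ K, ⟪v, Y⟫ = suppFn K Y := by
  obtain ⟨v, hv, h, -⟩ := hK.exists_sSup_image_eq_and_ge hne
    (f := fun y => ⟪y, Y⟫) (by fun_prop)
  exact ⟨v, hv, h.symm⟩

lemma suppFn_alexandrovBody_le {g : Euc n → ℝ} (hne : (alexandrovBody g).Nonempty)
    {Y : Euc n} (hY : Y ∈ sphere (0 : Euc n) 1) : suppFn (alexandrovBody g) Y ≤ g Y :=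
  csSup_le (hne.image _) (by rintro _ ⟨y, hy, rfl⟩; exact hy Y hY)

lemma inner_le_suppFn_alexandrovBody {g : Euc n → ℝ} {y Y : Euc n} (hy : y ∈ alexandrovBody g)
    (hY : Y ∈ sphere (0 : Euc n) 1) : ⟪y, Y⟫ ≤ suppFn (alexandrovBody g) Y :=
  le_csSup ⟨g Y, by rintro _ ⟨z, hz, rfl⟩; exact hz Y hY⟩ (mem_image_of_mem _ hy)

lemma gaussMap_spec {K : Set (Euc n)} {x : Euc n} (h : ∃! X, IsOuterNormalAt K x X) :
    IsOuterNormalAt K x (gaussMap K x) := by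
  rw [gaussMap, dif_pos h]
  exact h.choose_spec.1

lemma IsOuterNormalAt.suppFn_eq {K : Set (Euc n)} {x X : Euc n} (hX : IsOuterNormalAt K x X)
    (hx : x ∈ K) : suppFn K X = ⟪x, X⟫ :=
  IsGreatest.csSup_eq ⟨mem_image_of_mem _ hx, by rintro _ ⟨y, hy, rfl⟩; exact hX.2 y hy⟩

/-- If `X` is the only outer unit normal of `K` at `x`, then pushing a point of `K` slightly towards
`x` and moving it by almost `t f(X)` in direction `X` yields a point of `B[h + tf]`. -/
lemma exists_combination_mem_alexandrovBody {K : Set (Euc n)} (hK : IsCompact K)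
    {f : Euc n → ℝ} (hf : ContinuousOn f (sphere (0 : Euc n) 1)) {x X : Euc n} (hx : x ∈ K)
    (hX : IsOuterNormalAt K x X) (huniq : ∀ Y, IsOuterNormalAt K x Y → Y = X)
    {ε : ℝ} (hε : 0 < ε) :
    ∃ M : ℝ, 0 ≤ M ∧ ∀ t : ℝ, M * |t| ≤ 1 → ∀ v ∈ K,
      (1 - M * |t|) • v + (M * |t|) • x + (t * f X - ε * |t|) • X ∈
        alexandrovBody (fun Y => suppFn K Y + t * f Y) := by
  obtain ⟨M, hM, hMg⟩ := exists_neg_le_mul_of_pos_on_zero (isCompact_sphere (0 : Euc n) 1)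
    (p := fun Y => suppFn K Y - ⟪x, Y⟫)
    (g := fun Y => ε * ⟪X, Y⟫ - |f X * ⟪X, Y⟫ - f Y|)
    (((continuous_suppFn hK).sub (by fun_prop)).continuousOn)
    (by fun_prop)
    (fun Y _ => sub_nonneg.2 (inner_le_suppFn hK hx Y))
    (by
      intro Y hY h
      have hYX : Y = X := huniq Y ⟨by simpa using hY, fun y hy => by
        rw [← sub_eq_zero.1 h]; exact inner_le_suppFn hK hy Y⟩
      subst hYX
      simpa [real_inner_self_eq_norm_sq, hX.1] using hε)
  refine ⟨M, hM, fun t ht v hv Y hY => ?_⟩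
  have hvY := mul_le_mul_of_nonneg_left (inner_le_suppFn hK hv Y) (sub_nonneg.2 ht)
  have hg := mul_le_mul_of_nonneg_left (hMg Y hY) (abs_nonneg t)
  have habs : t * (f X * ⟪X, Y⟫ - f Y) ≤ |t| * |f X * ⟪X, Y⟫ - f Y| := by
    rw [← abs_mul]; exact le_abs_self _
  simp only [inner_add_left, real_inner_smul_left]
  linarith

/-- If the Gauss map `ν` of `cl(Ω)` is defined and continuous at `x ∈ ∂Ω`, `X = ν(x)`,
and `X_t ∈ S^{n-1}` with `X_t → X` as `t → 0`, then
`(h_t(X_t) - h(X_t))/t → f(X)` as `t → 0`, where `h_t` is the support function of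
`B[h + tf]`. -/
theorem tendsto_suppFn_alexandrov_quotient (Ω : Set (Euc n))
    (hΩo : IsOpen Ω) (hΩb : IsBounded Ω) (hΩc : Convex ℝ Ω)
    (h0 : (0 : Euc n) ∈ Ω)
    (f : Euc n → ℝ) (hf : ContinuousOn f (sphere (0 : Euc n) 1))
    (x : Euc n) (hx : x ∈ frontier Ω)
    (hdx : ∃! X, IsOuterNormalAt (closure Ω) x X)
    (hcont : ContinuousWithinAt (gaussMap (closure Ω)) (frontier Ω) x)
    (Xt : ℝ → Euc n) (hXt : ∀ t, Xt t ∈ sphere (0 : Euc n) 1)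
    (hXc : Tendsto Xt (𝓝[≠] (0 : ℝ)) (𝓝 (gaussMap (closure Ω) x))) :
    Tendsto
      (fun t : ℝ =>
        (suppFn (alexandrovBody (fun Y => suppFn (closure Ω) Y + t * f Y)) (Xt t) -
            suppFn (closure Ω) (Xt t)) / t)
      (𝓝[≠] (0 : ℝ)) (𝓝 (f (gaussMap (closure Ω) x))) := by
  set K := closure Ω
  have hK : IsCompact K := hΩb.isCompact_closure
  have hxK : x ∈ K := frontier_subset_closure hx
  have hX := gaussMap_spec hdx
  set X := gaussMap K x
  have hXX : ⟪X, X⟫ = 1 := by rw [real_inner_self_eq_norm_sq, hX.1]; norm_num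
  have hfX : Tendsto (fun t => f (Xt t)) (𝓝[≠] (0 : ℝ)) (𝓝 (f X)) :=
    (hf X (by simpa using hX.1)).tendsto.comp
      (tendsto_nhdsWithin_iff.2 ⟨hXc, Eventually.of_forall hXt⟩)
  have hpX : Tendsto (fun t => suppFn K (Xt t) - ⟪x, Xt t⟫) (𝓝[≠] (0 : ℝ)) (𝓝 0) := by
    have h : Continuous fun Y => suppFn K Y - ⟪x, Y⟫ :=
      (continuous_suppFn hK).sub (by fun_prop)
    have h' := (h.tendsto X).comp hXc
    rwa [hX.suppFn_eq hxK, sub_self] at h'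
  have hiX : Tendsto (fun t => ⟪X, Xt t⟫) (𝓝[≠] (0 : ℝ)) (𝓝 1) := by
    rw [← hXX]
    exact tendsto_const_nhds.inner hXc
  rw [Metric.tendsto_nhds]
  intro η hη
  obtain ⟨M, -, hMmem⟩ := exists_combination_mem_alexandrovBody hK hf hxK hX
    (fun Y hY => hdx.unique hY hX) (half_pos hη)
  have hlow : Tendsto (fun t => M * (suppFn K (Xt t) - ⟪x, Xt t⟫) +
      |f X * (1 - ⟪X, Xt t⟫)| + η / 2 * ⟪X, Xt t⟫) (𝓝[≠] (0 : ℝ)) (𝓝 (η / 2)) := by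
    have := ((hpX.const_mul M).add ((hiX.const_sub 1).const_mul (f X)).abs).add
      (hiX.const_mul (η / 2))
    simpa using this
  have hsmall : Tendsto (fun t : ℝ => M * |t|) (𝓝[≠] (0 : ℝ)) (𝓝 0) := by
    have h : Continuous fun t : ℝ => M * |t| := by fun_prop
    simpa using (h.tendsto 0).mono_left nhdsWithin_le_nhds
  filter_upwards [hlow.eventually_lt_const (half_lt_self hη),
    hsmall.eventually_le_const one_pos, (Metric.tendsto_nhds.1 hfX) η hη,
    self_mem_nhdsWithin] with t h1 h2 h3 ht
  have ht0 : 0 < |t| := abs_pos.2 ht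
  obtain ⟨v, hv, hvX⟩ := exists_inner_eq_suppFn hK ⟨x, hxK⟩ (Xt t)
  have hmem := hMmem t h2 v hv
  have hup := suppFn_alexandrovBody_le ⟨_, hmem⟩ (hXt t)
  have hge := inner_le_suppFn_alexandrovBody hmem (hXt t)
  simp only [inner_add_left, real_inner_smul_left, hvX] at hge
  set H := suppFn (alexandrovBody fun Y => suppFn K Y + t * f Y) (Xt t)
  rw [Real.dist_eq] at h3 ⊢
  have hquot : (H - suppFn K (Xt t)) / t - f X = (H - suppFn K (Xt t) - t * f X) / t := by
    field_simp [show t ≠ 0 from ht]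
  rw [hquot, abs_div, div_lt_iff₀ ht0, abs_lt]
  constructor
  · have ha : t * (f X * (1 - ⟪X, Xt t⟫)) ≤ |t| * |f X * (1 - ⟪X, Xt t⟫)| := by
      rw [← abs_mul]; exact le_abs_self _
    have hb := mul_lt_mul_of_pos_left h1 ht0
    linarith
  · have ha : t * (f (Xt t) - f X) ≤ |t| * |f (Xt t) - f X| := by
      rw [← abs_mul]; exact le_abs_self _
    have hb := mul_lt_mul_of_pos_left h3 ht0
    linarith

end
end

section
/- Let μ be a non-negative Borel measure on S^{n−1} with ∫_{S^{n−1}} X dμ(X) = 0 and support not contained in any great subsphere, and let M > 0. Then there exist positive numbers r, R depending only on n, μ and M such that: for every open bounded convex set Ω ⊂ ℝ^n satisfying τ(Ω) ≥ 1 and ∫_{S^{n−1}} h(X) dμ(X) ≤ M (h the support function of cl(Ω)), there exists x₀ ∈ ℝ^n with B(x₀, r) ⊂ Ω ⊂ B(x₀, R). -/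
open MeasureTheory Metric Set Filter Bornology
open scoped Topology Pointwise RealInnerProductSpace ENNReal NNReal BigOperators Classical

noncomputable section

variable {n : ℕ}

theorem deriv_deriv_nonpos_of_isLocalMax {f : ℝ → ℝ} {x : ℝ} (hf : ContinuousAt f x)
    (h : IsLocalMax f x) : deriv (deriv f) x ≤ 0 := by
  by_contra! hpos
  have hmin : IsLocalMin f x := isLocalMin_of_deriv_deriv_pos hpos h.deriv_eq_zero hf
  have hconst : f =ᶠ[𝓝 x] fun _ => f x := by
    filter_upwards [h, hmin] with y h₁ h₂ using le_antisymm h₁ h₂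
  have : deriv (deriv f) x = 0 := by
    rw [hconst.deriv.deriv_eq]
    simp
  exact hpos.ne' this

theorem lapl_eq_sum_fderiv (u : Euc n → ℝ) (x : Euc n) :
    lapl u x = ∑ i : Fin n, fderiv ℝ (fderiv ℝ u) x (EuclideanSpace.single i 1)
      (EuclideanSpace.single i 1) := by
  simp [lapl, iteratedFDeriv_two_apply]

theorem lapl_nonpos_of_isLocalMax {g : Euc n → ℝ} {x : Euc n} (hg : ContDiffAt ℝ 2 g x)
    (h : IsLocalMax g x) : lapl g x ≤ 0 := by
  rw [lapl_eq_sum_fderiv]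
  refine Finset.sum_nonpos fun i _ => ?_
  set e : Euc n := EuclideanSpace.single i 1
  have hline : ∀ t : ℝ, HasDerivAt (fun t : ℝ => x + t • e) e t := fun t => by
    simpa using ((hasDerivAt_id t).smul_const e).const_add x
  have htend : Tendsto (fun t : ℝ => x + t • e) (𝓝 0) (𝓝 x) := by
    have := (hline 0).continuousAt.tendsto
    simpa using this
  have hdiff : ∀ᶠ y in 𝓝 x, DifferentiableAt ℝ g y := by
    filter_upwards [hg.eventually (by simp)] with y hy using hy.differentiableAt (by simp)
  have hd : deriv (fun t : ℝ => g (x + t • e)) =ᶠ[𝓝 0] fun t => fderiv ℝ g (x + t • e) e := by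
    filter_upwards [htend.eventually hdiff] with t ht
    exact (ht.hasFDerivAt.comp_hasDerivAt t (hline t)).deriv
  have h2 : DifferentiableAt ℝ (fderiv ℝ g) x :=
    (hg.fderiv_right (m := 1) (by norm_num)).differentiableAt (by simp)
  have hdd : HasDerivAt (fun t : ℝ => fderiv ℝ g (x + t • e) e) (fderiv ℝ (fderiv ℝ g) x e e) 0 := by
    have h2' : HasFDerivAt (fderiv ℝ g) (fderiv ℝ (fderiv ℝ g) x) (x + (0 : ℝ) • e) := by
      simpa using h2.hasFDerivAt
    have := ((h2'.comp_hasDerivAt 0 (hline 0)).hasFDerivAt.clm_apply (hasFDerivAt_const e 0)).hasDerivAt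
    simpa using this
  have hmax : IsLocalMax (fun t : ℝ => g (x + t • e)) 0 := by
    have := htend.eventually h
    simpa [IsLocalMax, IsMaxFilter] using this
  have hc : ContinuousAt (fun t : ℝ => g (x + t • e)) 0 := by
    have : ContinuousAt g (x + (0 : ℝ) • e) := by simpa using hg.continuousAt
    exact ContinuousAt.comp (f := fun t : ℝ => x + t • e) this (hline 0).continuousAt
  have key := deriv_deriv_nonpos_of_isLocalMax hc hmax
  rwa [hd.deriv_eq, hdd.deriv] at key

theorem lapl_sub {f g : Euc n → ℝ} {x : Euc n} (hf : ContDiffAt ℝ 2 f x)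
    (hg : ContDiffAt ℝ 2 g x) : lapl (fun y => f y - g y) x = lapl f x - lapl g x := by
  change lapl (f - g) x = _
  simp only [lapl, ← Finset.sum_sub_distrib]
  refine Finset.sum_congr rfl fun i _ => ?_
  rw [iteratedFDeriv_sub_apply hf hg]
  rfl

theorem lapl_neg (f : Euc n → ℝ) (x : Euc n) : lapl (fun y => -f y) x = -lapl f x := by
  change lapl (-f) x = _
  simp [lapl, iteratedFDeriv_neg_apply]

theorem lapl_quadratic (a b c : ℝ) (e x : Euc n) :
    lapl (fun z => a * (c - ⟪e, z⟫) - b * (c - ⟪e, z⟫) ^ 2) x = -2 * b * ‖e‖ ^ 2 := by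
  have h1 : ∀ z : Euc n, HasFDerivAt (fun z => c - ⟪e, z⟫) (-(innerSL ℝ e)) z := fun z =>
    ((innerSL ℝ e).hasFDerivAt).const_sub c
  have h2 : fderiv ℝ (fun z => a * (c - ⟪e, z⟫) - b * (c - ⟪e, z⟫) ^ 2) =
      fun z => (2 * b * (c - ⟪e, z⟫) - a) • innerSL ℝ e := by
    funext z
    refine (((h1 z).const_mul a).sub (((h1 z).pow 2).const_mul b)).fderiv.trans ?_
    ext v
    simp
    ring
  rw [lapl_eq_sum_fderiv, h2]
  have h3 : fderiv ℝ (fun z => (2 * b * (c - ⟪e, z⟫) - a) • innerSL ℝ e) x =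
      ((2 * b) • (-(innerSL ℝ e))).smulRight (innerSL ℝ e) :=
    ((((h1 x).const_mul (2 * b)).sub_const a).smul_const (innerSL ℝ e)).fderiv
  rw [h3, EuclideanSpace.norm_sq_eq, Finset.mul_sum]
  refine Finset.sum_congr rfl fun i _ => ?_
  simp [EuclideanSpace.inner_single_right]
  ring

theorem contDiff_quadratic (a b c : ℝ) (e : Euc n) :
    ContDiff ℝ 2 (fun z => a * (c - ⟪e, z⟫) - b * (c - ⟪e, z⟫) ^ 2) := by
  have h : ContDiff ℝ 2 fun z : Euc n => ⟪e, z⟫ := (innerSL ℝ e).contDiff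
  fun_prop

theorem IsTorsionFunction.contDiffAt {Ω : Set (Euc n)} {u : Euc n → ℝ}
    (hu : IsTorsionFunction Ω u) (hΩ : IsOpen Ω) {x : Euc n} (hx : x ∈ Ω) :
    ContDiffAt ℝ 2 u x :=
  (hu.smooth.contDiffAt (hΩ.mem_nhds hx)).of_le (WithTop.coe_le_coe.2 (le_top : (2 : ℕ∞) ≤ ⊤))

theorem IsTorsionFunction.pos {Ω : Set (Euc n)} {u : Euc n → ℝ}
    (hu : IsTorsionFunction Ω u) (hΩ : IsOpen Ω) (hb : IsBounded Ω) {x : Euc n} (hx : x ∈ Ω) :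
    0 < u x := by
  obtain ⟨z, hz, hmin⟩ := hb.isCompact_closure.exists_isMinOn ⟨x, subset_closure hx⟩
    hu.continuousOn
  have hnot : ∀ y ∈ Ω, ¬ IsMinOn u (closure Ω) y := fun y hy hmin => by
    have hmax : IsLocalMax (-u) y :=
      (hmin.isLocalMin (mem_of_superset (hΩ.mem_nhds hy) subset_closure)).neg
    have := lapl_nonpos_of_isLocalMax (hu.contDiffAt hΩ hy).neg hmax
    rw [lapl_neg, hu.lapl_eq y hy] at this
    norm_num at this
  have hz0 : u z = 0 := hu.boundary_zero z ⟨hz, fun h => hnot z (interior_subset h) hmin⟩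
  have hx0 : 0 ≤ u x := hz0 ▸ hmin (subset_closure hx)
  refine lt_of_le_of_ne hx0 fun h => hnot x hx fun y hy => ?_
  have : u z ≤ u y := hmin hy
  simpa [← h, ← hz0] using this

/-- If every inscribed ball of `Ω` has radius less than `ρ`, then the torsion function is at most
`2ρ²`. -/
theorem IsTorsionFunction.le_of_infDist_lt {Ω : Set (Euc n)} {u : Euc n → ℝ}
    (hu : IsTorsionFunction Ω u) (hΩ : IsOpen Ω) (hb : IsBounded Ω) (hconv : Convex ℝ Ω)
    (hc : Ωᶜ.Nonempty) {ρ : ℝ} (hρ : ∀ x ∈ Ω, infDist x Ωᶜ < ρ) {x : Euc n} (hx : x ∈ Ω) :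
    u x ≤ 2 * ρ ^ 2 := by
  set d : Euc n → ℝ := fun z => infDist z Ωᶜ with hd
  have hdc : Continuous d := continuous_infDist_pt _
  obtain ⟨z, hz, hmax⟩ := hb.isCompact_closure.exists_isMaxOn ⟨x, subset_closure hx⟩
    (f := fun z => u z - (4 * ρ * d z - 2 * d z ^ 2))
    (hu.continuousOn.sub (by fun_prop))
  have hxz : u x - (4 * ρ * d x - 2 * d x ^ 2) ≤ u z - (4 * ρ * d z - 2 * d z ^ 2) :=
    hmax (subset_closure hx)
  have hznot : z ∉ Ω := by
    intro hzΩ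
    obtain ⟨y, hy, hzy⟩ := hΩ.isClosed_compl.exists_infDist_eq_dist hc z
    obtain ⟨f, hf⟩ := geometric_hahn_banach_open_point hconv hΩ hy
    set w : Euc n := (InnerProductSpace.toDual ℝ (Euc n)).symm f with hw
    have hfw : ∀ v, f v = ⟪w, v⟫ := fun v => by simp [hw]
    have hw0 : w ≠ 0 := by
      intro h0
      have := hf z hzΩ
      simp [hfw, h0] at this
    set e : Euc n := ‖w‖⁻¹ • w with he
    have hwpos : 0 < ‖w‖ := norm_pos_iff.2 hw0
    have hen : ‖e‖ = 1 := by simp [he, norm_smul, hwpos.ne']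
    have hsep : ∀ p ∈ Ω, ⟪e, p⟫ < ⟪e, y⟫ := fun p hp => by
      have := hf p hp
      rw [hfw, hfw] at this
      simp only [he, real_inner_smul_left]
      gcongr
    have hle : ∀ p ∈ Ω, d p ≤ ⟪e, y⟫ - ⟪e, p⟫ := fun p hp => by
      have hq : p + (⟪e, y⟫ - ⟪e, p⟫) • e ∈ Ωᶜ := fun hq => by
        have := hsep _ hq
        simp [inner_add_right, real_inner_smul_right, hen] at this
      refine (infDist_le_dist_of_mem hq).trans ?_
      rw [dist_self_add_right, norm_smul, hen, mul_one, Real.norm_eq_abs,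
        abs_of_pos (sub_pos.2 (hsep p hp))]
    have heq : d z = ⟪e, y⟫ - ⟪e, z⟫ := by
      refine le_antisymm (hle z hzΩ) ?_
      have := real_inner_le_norm e (y - z)
      rw [hen, one_mul, inner_sub_right, ← dist_eq_norm, dist_comm, ← hzy] at this
      exact this
    set v : Euc n → ℝ := fun p => 4 * ρ * (⟪e, y⟫ - ⟪e, p⟫) - 2 * (⟪e, y⟫ - ⟪e, p⟫) ^ 2 with hv
    have hev : ∀ᶠ p in 𝓝 z, ⟪e, y⟫ - ⟪e, p⟫ < ρ := by
      have hcont : Continuous fun p : Euc n => ⟪e, y⟫ - ⟪e, p⟫ := by fun_prop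
      exact hcont.continuousAt.eventually_lt_const (heq.symm.trans_lt (hρ z hzΩ))
    have hloc : IsLocalMax (u - v) z := by
      filter_upwards [hev, hΩ.mem_nhds hzΩ] with p hp hpΩ
      have h1 : u p - (4 * ρ * d p - 2 * d p ^ 2) ≤ u z - (4 * ρ * d z - 2 * d z ^ 2) :=
        hmax (subset_closure hpΩ)
      have h2 := hle p hpΩ
      simp only [Pi.sub_apply, hv]
      rw [← heq]
      nlinarith
    have := lapl_nonpos_of_isLocalMax
      ((hu.contDiffAt hΩ hzΩ).sub (contDiff_quadratic _ _ _ _).contDiffAt) hloc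
    rw [lapl_sub (hu.contDiffAt hΩ hzΩ) (contDiff_quadratic _ _ _ _).contDiffAt,
      lapl_quadratic, hu.lapl_eq z hzΩ, hen] at this
    norm_num at this
  have hz0 : u z = 0 := hu.boundary_zero z ⟨hz, fun h => hznot (interior_subset h)⟩
  have hdz : d z = 0 := infDist_zero_of_mem hznot
  rw [hz0, hdz] at hxz
  nlinarith [sq_nonneg (ρ - d x)]

theorem norm_gradient_sq (u : Euc n → ℝ) (x : Euc n) :
    ‖gradient u x‖ ^ 2 = ∑ i : Fin n, fderiv ℝ u x (EuclideanSpace.single i 1) ^ 2 := by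
  rw [EuclideanSpace.norm_sq_eq]
  refine Finset.sum_congr rfl fun i _ => ?_
  have h : fderiv ℝ u x (EuclideanSpace.single i 1) = gradient u x i := by
    rw [← InnerProductSpace.toDual_symm_apply, EuclideanSpace.inner_single_right]
    simp [gradient]
  rw [h, Real.norm_eq_abs, sq_abs]

theorem integral_fderiv_apply_eq_zero {W : Euc n → ℝ} (hW : ContDiff ℝ 1 W)
    (hs : HasCompactSupport W) (v : Euc n) :
    Integrable (fun x => fderiv ℝ W x v) ∧ ∫ x, fderiv ℝ W x v = 0 := by
  have hc : Continuous fun x => fderiv ℝ W x v := (hW.continuous_fderiv (by simp)).clm_apply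
    continuous_const
  have hi : Integrable fun x => fderiv ℝ W x v :=
    hc.integrable_of_hasCompactSupport (hs.fderiv_apply ℝ v)
  refine ⟨hi, ?_⟩
  have := integral_mul_fderiv_eq_neg_fderiv_mul_of_integrable (μ := (volume : Measure (Euc n)))
    (f := fun _ => (1 : ℝ)) (g := W) (v := v) (by simp) (by simpa using hi)
    (by simpa using hW.continuous.integrable_of_hasCompactSupport hs)
    (fun x _ => by fun_prop) (fun x _ => hW.differentiable (by simp) x)
  simpa using this

/-- A continuous ramp, `0` on `(-∞, δ]` and `1` on `[2δ, ∞)`. -/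
def ramp (δ s : ℝ) : ℝ := max 0 (min 1 (s / δ - 1))

theorem continuous_ramp (δ : ℝ) : Continuous (ramp δ) := by
  unfold ramp; fun_prop

theorem ramp_nonneg (δ s : ℝ) : 0 ≤ ramp δ s := le_max_left _ _

theorem ramp_le_one (δ s : ℝ) : ramp δ s ≤ 1 := max_le zero_le_one (min_le_left _ _)

theorem ramp_of_le {δ s : ℝ} (hδ : 0 < δ) (h : s ≤ δ) : ramp δ s = 0 := by
  refine max_eq_left ((min_le_right _ _).trans ?_)
  rw [sub_nonpos]
  exact (div_le_one hδ).2 h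

theorem ramp_of_ge {δ s : ℝ} (hδ : 0 < δ) (h : 2 * δ ≤ s) : ramp δ s = 1 := by
  have : 1 ≤ s / δ - 1 := by
    rw [le_sub_iff_add_le, le_div_iff₀ hδ]
    linarith
  simp [ramp, min_eq_left this]

/-- The primitive of `ramp δ` vanishing at `0`. -/
def rampPrimitive (δ t : ℝ) : ℝ := ∫ s in (0 : ℝ)..t, ramp δ s

theorem hasDerivAt_rampPrimitive (δ t : ℝ) : HasDerivAt (rampPrimitive δ) (ramp δ t) t :=
  (continuous_ramp δ).integral_hasStrictDerivAt 0 t |>.hasDerivAt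

theorem contDiff_rampPrimitive (δ : ℝ) : ContDiff ℝ 1 (rampPrimitive δ) := by
  rw [contDiff_one_iff_deriv]
  refine ⟨fun t => (hasDerivAt_rampPrimitive δ t).differentiableAt, ?_⟩
  rw [funext fun t => (hasDerivAt_rampPrimitive δ t).deriv]
  exact continuous_ramp δ

theorem rampPrimitive_of_le {δ t : ℝ} (hδ : 0 < δ) (h : t ≤ δ) : rampPrimitive δ t = 0 := by
  unfold rampPrimitive
  rw [intervalIntegral.integral_congr (g := fun _ => 0)]
  · simp
  · intro s hs
    exact ramp_of_le hδ (hs.2.trans (max_le hδ.le h))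

theorem rampPrimitive_le {δ t : ℝ} (ht : 0 ≤ t) : rampPrimitive δ t ≤ t := by
  have := intervalIntegral.integral_mono_on (μ := volume) ht
    ((continuous_ramp δ).intervalIntegrable 0 t) (g := fun _ => 1) (by simp)
    fun s _ => ramp_le_one δ s
  simpa [rampPrimitive] using this

namespace IsTorsionFunction

variable {Ω : Set (Euc n)} {u : Euc n → ℝ}

theorem isCompact_superlevel (hu : IsTorsionFunction Ω u) (hb : IsBounded Ω) (δ : ℝ) :
    IsCompact (closure Ω ∩ u ⁻¹' Ici δ) :=
  hb.isCompact_closure.of_isClosed_subset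
    (hu.continuousOn.preimage_isClosed_of_isClosed isClosed_closure isClosed_Ici)
    inter_subset_left

theorem superlevel_subset (hu : IsTorsionFunction Ω u) {δ : ℝ} (hδ : 0 < δ) :
    closure Ω ∩ u ⁻¹' Ici δ ⊆ Ω := by
  rintro x ⟨hx, hxδ⟩
  by_contra h
  have := hu.boundary_zero x ⟨hx, fun h' => h (interior_subset h')⟩
  rw [mem_preimage, this] at hxδ
  exact absurd hxδ (not_le.2 hδ)

theorem integral_ramp (hu : IsTorsionFunction Ω u) (hΩ : IsOpen Ω) (hb : IsBounded Ω)
    {δ : ℝ} (hδ : 0 < δ) :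
    Integrable (Ω.indicator fun x =>
        ramp δ (u x) * ‖gradient u x‖ ^ 2 - 2 * rampPrimitive δ (u x)) ∧
      ∫ x, Ω.indicator (fun x =>
        ramp δ (u x) * ‖gradient u x‖ ^ 2 - 2 * rampPrimitive δ (u x)) x = 0 := by
  set e : Fin n → Euc n := fun i => EuclideanSpace.single i 1 with he
  set W : Fin n → Euc n → ℝ := fun i =>
    Ω.indicator fun x => rampPrimitive δ (u x) * fderiv ℝ u x (e i) with hW
  set K := closure Ω ∩ u ⁻¹' Ici δ with hK
  have hKc : IsCompact K := hu.isCompact_superlevel hb δ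
  have hKΩ : K ⊆ Ω := hu.superlevel_subset hδ
  have hW0 : ∀ i, ∀ x ∉ K, W i x = 0 := fun i x hx => by
    by_cases hxΩ : x ∈ Ω
    · have : u x ≤ δ := by
        by_contra! h
        exact hx ⟨subset_closure hxΩ, h.le⟩
      simp [hW, rampPrimitive_of_le hδ this]
    · simp [hW, hxΩ]
  have hWev0 : ∀ i, ∀ x ∉ Ω, W i =ᶠ[𝓝 x] fun _ => 0 := fun i x hx => by
    filter_upwards [hKc.isClosed.isOpen_compl.mem_nhds fun h => hx (hKΩ h)] with y hy
      using hW0 i y hy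
  have hWev : ∀ i, ∀ x ∈ Ω, W i =ᶠ[𝓝 x] fun x => rampPrimitive δ (u x) * fderiv ℝ u x (e i) :=
    fun i x hx => by
      filter_upwards [hΩ.mem_nhds hx] with y hy
      simp [hW, hy]
  have hWc : ∀ i, ContDiff ℝ 1 (W i) := fun i => contDiff_iff_contDiffAt.2 fun x => by
    by_cases hx : x ∈ Ω
    · refine ContDiffAt.congr_of_eventuallyEq ?_ (hWev i x hx)
      have h2 := hu.contDiffAt hΩ hx
      exact ((contDiff_rampPrimitive δ).contDiffAt.comp x (h2.of_le (by norm_num))).mul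
        ((h2.fderiv_right (m := 1) (by norm_num)).clm_apply contDiffAt_const)
    · exact contDiffAt_const.congr_of_eventuallyEq (hWev0 i x hx)
  have hWs : ∀ i, HasCompactSupport (W i) := fun i => HasCompactSupport.intro hKc (hW0 i)
  have hsum : (Ω.indicator fun x =>
      ramp δ (u x) * ‖gradient u x‖ ^ 2 - 2 * rampPrimitive δ (u x)) =
      fun x => ∑ i, fderiv ℝ (W i) x (e i) := by
    funext x
    by_cases hx : x ∈ Ω
    · have h2 := hu.contDiffAt hΩ hx
      have hfd : ∀ i, fderiv ℝ (W i) x (e i) = ramp δ (u x) * fderiv ℝ u x (e i) ^ 2 +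
          rampPrimitive δ (u x) * fderiv ℝ (fderiv ℝ u) x (e i) (e i) := fun i => by
        have hd := (h2.differentiableAt (by simp)).hasFDerivAt
        have hdd := ((h2.fderiv_right (m := 1) (by norm_num)).differentiableAt
          (by simp)).hasFDerivAt
        have h1 := ((hasDerivAt_rampPrimitive δ (u x)).comp_hasFDerivAt x hd).mul
          (hdd.clm_apply (hasFDerivAt_const (e i) x))
        rw [(h1.congr_of_eventuallyEq (hWev i x hx)).fderiv]
        simp
        ring
      have hl := hu.lapl_eq x hx
      rw [lapl_eq_sum_fderiv] at hl
      rw [indicator_of_mem hx, Finset.sum_congr rfl fun i _ => hfd i, Finset.sum_add_distrib,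
        ← Finset.mul_sum, ← Finset.mul_sum, hl, norm_gradient_sq]
      ring
    · rw [indicator_of_notMem hx]
      refine (Finset.sum_eq_zero fun i _ => ?_).symm
      rw [(hWev0 i x hx).fderiv_eq]
      simp
  have hint := fun i => integral_fderiv_apply_eq_zero (hWc i) (hWs i) (e i)
  rw [hsum]
  refine ⟨integrable_finsetSum _ fun i _ => (hint i).1, ?_⟩
  rw [integral_finsetSum _ fun i _ => (hint i).1]
  exact Finset.sum_eq_zero fun i _ => (hint i).2

theorem integral_norm_gradient_sq_le (hu : IsTorsionFunction Ω u) (hΩ : IsOpen Ω)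
    (hb : IsBounded Ω) {C : ℝ} (hC : ∀ x ∈ Ω, u x ≤ C) :
    ∫ x in Ω, ‖gradient u x‖ ^ 2 ≤ 2 * C * volume.real Ω := by
  by_cases hint : IntegrableOn (fun x => ‖gradient u x‖ ^ 2) Ω
  swap
  · rw [integral_undef hint]
    rcases Ω.eq_empty_or_nonempty with rfl | ⟨x, hx⟩
    · simp
    · have := (hu.pos hΩ hb hx).le.trans (hC x hx)
      positivity
  have hmeas : MeasurableSet Ω := hΩ.measurableSet
  have hfin : volume Ω ≠ ⊤ := hb.measure_lt_top.ne
  have hcont : ContinuousOn u Ω := hu.continuousOn.mono subset_closure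
  have hbound : ∀ δ > 0, ∫ x in Ω, ramp δ (u x) * ‖gradient u x‖ ^ 2 ≤
      2 * C * volume.real Ω := fun δ hδ => by
    obtain ⟨h1, h2⟩ := hu.integral_ramp hΩ hb hδ
    rw [integrable_indicator_iff hmeas] at h1
    rw [integral_indicator hmeas] at h2
    have hP : IntegrableOn (fun x => 2 * rampPrimitive δ (u x)) Ω := by
      refine IntegrableOn.mono_set (ContinuousOn.integrableOn_compact hb.isCompact_closure ?_)
        subset_closure
      exact continuousOn_const.mul
        ((contDiff_rampPrimitive δ).continuous.comp_continuousOn hu.continuousOn)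
    have h3 : ∫ x in Ω, ramp δ (u x) * ‖gradient u x‖ ^ 2 =
        ∫ x in Ω, 2 * rampPrimitive δ (u x) := by
      have := integral_add h1 hP
      simpa [h2] using this
    rw [h3]
    have h4 : ∫ x in Ω, 2 * rampPrimitive δ (u x) ≤ ∫ _ in Ω, 2 * C := by
      refine setIntegral_mono_on hP (integrableOn_const hfin) hmeas fun x hx => ?_
      have := rampPrimitive_le (δ := δ) (hu.pos hΩ hb hx).le
      linarith [hC x hx]
    refine h4.trans_eq ?_
    rw [setIntegral_const, smul_eq_mul, mul_comm]
  have hlim : Tendsto (fun k : ℕ => ∫ x in Ω, ramp (1 / ((k : ℝ) + 1)) (u x) * ‖gradient u x‖ ^ 2)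
      atTop (𝓝 (∫ x in Ω, ‖gradient u x‖ ^ 2)) := by
    refine tendsto_integral_of_dominated_convergence (fun x => ‖gradient u x‖ ^ 2) (fun k => ?_)
      hint (fun k => ?_) ?_
    · exact (((continuous_ramp _).comp_continuousOn hcont).aestronglyMeasurable hmeas).mul
        hint.aestronglyMeasurable
    · refine Eventually.of_forall fun x => ?_
      rw [norm_mul, Real.norm_of_nonneg (ramp_nonneg _ _), Real.norm_of_nonneg (sq_nonneg _)]
      exact mul_le_of_le_one_left (sq_nonneg _) (ramp_le_one _ _)
    · filter_upwards [ae_restrict_mem hmeas] with x hx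
      refine tendsto_const_nhds.congr' ?_
      have hpos := half_pos (hu.pos hΩ hb hx)
      filter_upwards [tendsto_one_div_add_atTop_nhds_zero_nat.eventually_lt_const hpos] with k hk
      rw [ramp_of_ge (by positivity) (by linarith), one_mul]
  exact le_of_tendsto' hlim fun k => hbound _ (by positivity)

end IsTorsionFunction

theorem integrable_of_continuous_of_sphere {μ : Measure (Euc n)} [IsFiniteMeasure μ]
    (hsphere : μ (sphere (0 : Euc n) 1)ᶜ = 0) {F : Type*} [NormedAddCommGroup F]
    {f : Euc n → F} (hf : Continuous f) : Integrable f μ := by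
  have h : μ.restrict (sphere (0 : Euc n) 1) = μ :=
    Measure.restrict_eq_self_of_ae_mem (mem_ae_iff.2 hsphere)
  rw [← h]
  exact hf.continuousOn.integrableOn_compact (isCompact_sphere 0 1)

theorem exists_pos_mul_norm_le_integral_abs_inner (μ : Measure (Euc n)) [IsFiniteMeasure μ]
    (hsphere : μ (sphere (0 : Euc n) 1)ᶜ = 0)
    (hgreat : ∀ v : Euc n, v ≠ 0 → μ {X | ⟪X, v⟫ ≠ 0} ≠ 0) :
    ∃ c > 0, ∀ v : Euc n, c * ‖v‖ ≤ ∫ X, |⟪X, v⟫| ∂μ := by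
  have hpos : ∀ v : Euc n, v ≠ 0 → 0 < ∫ X, |⟪X, v⟫| ∂μ := fun v hv => by
    rw [integral_pos_iff_support_of_nonneg (fun X => abs_nonneg _)
      (integrable_of_continuous_of_sphere hsphere (by fun_prop))]
    refine pos_iff_ne_zero.2 ?_
    convert hgreat v hv using 2
    ext X
    simp
  have hcont : Continuous fun v : Euc n => ∫ X, |⟪X, v⟫| ∂μ := by
    have h : μ.restrict (sphere (0 : Euc n) 1) = μ :=
      Measure.restrict_eq_self_of_ae_mem (mem_ae_iff.2 hsphere)
    have := continuous_parametric_integral_of_continuous (μ := μ)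
      (f := fun v X : Euc n => |⟪X, v⟫|) (by unfold Function.uncurry; fun_prop)
      (isCompact_sphere (0 : Euc n) 1)
    rwa [h] at this
  rcases (sphere (0 : Euc n) 1).eq_empty_or_nonempty with hemp | hne
  · refine ⟨1, one_pos, fun v => ?_⟩
    have hv : v = 0 := by
      by_contra hv
      have : ‖v‖⁻¹ • v ∈ sphere (0 : Euc n) 1 := by
        simp [norm_smul, hv]
      simp [hemp] at this
    simp [hv]
  obtain ⟨w, hw, hmin⟩ := (isCompact_sphere (0 : Euc n) 1).exists_isMinOn hne hcont.continuousOn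
  refine ⟨_, hpos w (ne_of_mem_sphere hw one_ne_zero), fun v => ?_⟩
  rcases eq_or_ne v 0 with rfl | hv
  · simp
  have hvs : ‖v‖⁻¹ • v ∈ sphere (0 : Euc n) 1 := by simp [norm_smul, hv]
  have h := hmin hvs
  simp only [mem_ofPred_eq, real_inner_smul_right, abs_mul, abs_inv, abs_norm,
    integral_const_mul] at h
  rwa [← div_eq_inv_mul, le_div_iff₀ (norm_pos_iff.2 hv)] at h

theorem integral_abs_inner_sub_le {μ : Measure (Euc n)} [IsFiniteMeasure μ]
    (hsphere : μ (sphere (0 : Euc n) 1)ᶜ = 0) (hbar : ∫ X, X ∂μ = 0)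
    {K : Set (Euc n)} (hK : IsCompact K) {x y : Euc n} (hx : x ∈ K) (hy : y ∈ K) :
    ∫ X, |⟪X, x - y⟫| ∂μ ≤ 2 * ∫ X, suppFn K X ∂μ := by
  have hsupp : Continuous (suppFn K) := hK.continuous_sSup (f := fun X y => ⟪y, X⟫)
    (by change Continuous fun p : Euc n × Euc n => ⟪p.2, p.1⟫; fun_prop)
  have hle : ∀ z ∈ K, ∀ X, ⟪X, z⟫ ≤ suppFn K X := fun z hz X => by
    rw [real_inner_comm]
    exact le_csSup (hK.image (by fun_prop)).bddAbove (mem_image_of_mem _ hz)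
  have hzero : ∫ X, ⟪x + y, X⟫ ∂μ = 0 := by
    rw [integral_inner (f := fun X => X)
      (integrable_of_continuous_of_sphere hsphere continuous_id)]
    simp [hbar]
  have h : ∫ X, (|⟪X, x - y⟫| + ⟪x + y, X⟫) ∂μ ≤ ∫ X, 2 * suppFn K X ∂μ := by
    refine integral_mono (integrable_of_continuous_of_sphere hsphere (by fun_prop))
      (integrable_of_continuous_of_sphere hsphere (by fun_prop)) fun X => ?_
    have h1 := hle x hx X
    have h2 := hle y hy X
    rw [real_inner_comm X, inner_add_right, inner_sub_right]
    rcases abs_cases (⟪X, x⟫ - ⟪X, y⟫) with ⟨h, -⟩ | ⟨h, -⟩ <;> rw [h] <;> linarith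
  rw [integral_add (integrable_of_continuous_of_sphere hsphere (by fun_prop))
    (integrable_of_continuous_of_sphere hsphere (by fun_prop)), hzero, add_zero,
    integral_const_mul] at h
  exact h

/-- A priori inner and outer radius bounds: given `μ` as in the Minkowski problem and
`M > 0`, there are `r, R > 0` (depending only on `n`, `μ`, `M`) such that every open
bounded convex `Ω` with `τ(Ω) ≥ 1` and `∫ h_{cl(Ω)} dμ ≤ M` satisfies
`B(x₀, r) ⊆ Ω ⊆ B(x₀, R)` for some `x₀`. -/
theorem exists_inner_outer_radius (μ : Measure (Euc n)) [IsFiniteMeasure μ]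
    (hsphere : μ (sphere (0 : Euc n) 1)ᶜ = 0)
    (hbar : ∫ X, X ∂μ = 0)
    (hgreat : ∀ v : Euc n, v ≠ 0 → μ {X | ⟪X, v⟫ ≠ 0} ≠ 0)
    (M : ℝ) (hM : 0 < M) :
    ∃ r R : ℝ, 0 < r ∧ 0 < R ∧
      ∀ Ω : Set (Euc n), IsOpen Ω → IsBounded Ω → Convex ℝ Ω → Ω.Nonempty →
        1 ≤ torsionRigidity Ω → (∫ X, suppFn (closure Ω) X ∂μ) ≤ M →
          ∃ x₀ : Euc n, ball x₀ r ⊆ Ω ∧ Ω ⊆ ball x₀ R := by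
  obtain ⟨c, hc, hcle⟩ := exists_pos_mul_norm_le_integral_abs_inner μ hsphere hgreat
  set R : ℝ := 2 * M / c + 1 with hR
  have hRpos : 0 < R := by positivity
  set V : ℝ := volume.real (ball (0 : Euc n) R) with hV
  have hVnn : 0 ≤ V := measureReal_nonneg
  set r : ℝ := 1 / (2 * (V + 1)) with hr
  have hrpos : 0 < r := by positivity
  refine ⟨r, R, hrpos, hRpos, fun Ω hΩ hb hconv hne hτ hM' => ?_⟩
  have hdist : ∀ x ∈ Ω, Ω ⊆ ball x R := fun x hx y hy => by
    have h1 := integral_abs_inner_sub_le hsphere hbar hb.isCompact_closure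
      (subset_closure hy) (subset_closure hx)
    have h2 : c * ‖y - x‖ ≤ 2 * M := (hcle _).trans (by linarith)
    rw [mem_ball, dist_eq_norm]
    have : ‖y - x‖ ≤ 2 * M / c := by rwa [le_div_iff₀ hc, mul_comm]
    linarith
  suffices h : ∃ x ∈ Ω, r ≤ infDist x Ωᶜ by
    obtain ⟨x, hx, hxr⟩ := h
    refine ⟨x, fun y hy => ?_, hdist x hx⟩
    by_contra hyΩ
    have h1 : infDist x Ωᶜ ≤ dist x y := infDist_le_dist_of_mem hyΩ
    rw [mem_ball, dist_comm] at hy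
    linarith
  by_contra! hlt
  unfold torsionRigidity at hτ
  split_ifs at hτ with hex
  swap
  · norm_num at hτ
  have hu := hex.choose_spec
  set u := hex.choose
  obtain ⟨x₀, hx₀⟩ := hne
  have hcompl : Ωᶜ.Nonempty := by
    by_contra! h
    rw [compl_empty_iff] at h
    rcases n with _ | n
    · have := hu.lapl_eq x₀ hx₀
      simp [lapl] at this
    · exact NormedSpace.unbounded_univ ℝ (Euc (n + 1)) (h ▸ hb)
  have hbound := hu.integral_norm_gradient_sq_le hΩ hb fun x hx =>
    hu.le_of_infDist_lt hΩ hb hconv hcompl hlt hx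
  have hvol : volume.real Ω ≤ V := by
    rw [hV, ← Measure.addHaar_real_ball_center volume x₀]
    exact measureReal_mono (hdist x₀ hx₀) measure_ball_lt_top.ne
  have hfinal : 2 * (2 * r ^ 2) * V < 1 := by
    have : 2 * (2 * r ^ 2) * V = V / (V + 1) ^ 2 := by
      rw [hr]
      field_simp
    rw [this, div_lt_one (by positivity)]
    nlinarith
  have : 2 * (2 * r ^ 2) * volume.real Ω ≤ 2 * (2 * r ^ 2) * V := by gcongr
  linarith


end
end
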